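/- Cut player strategy for building small set expanders in O(log s) rounds. There are absolute constants c, c' ≥ 1 such that for every finite set V of even cardinality n ≥ 2 and every integer s with 2 ≤ s ≤ n/2, there exists a strategy σ assigning to every multigraph H on V (given by a symmetric multiplicity function w_H : V × V → ℕ with w_H(v,v) = 0) a collection σ(H) of at most c pairs (X, Y) of disjoint subsets of V with |X| = |Y|, with the following guarantee. Consider any sequence of multigraphs H₀, H₁, …, H_m with m ≥ c'·log s, where H₀ has no edges and, for each i, H_{i+1} is obtained from H_i by choosing, for each pair (X, Y) ∈ σ(H_i), an arbitrary bijection π : X → Y and increasing the multiplicity of the edge {x, π(x)} by 1 for every x ∈ X. Then every set S ⊆ V with 1 ≤ |S| ≤ s satisfies δ_{H_m}(S) ≥ |S|/c, where δ_{H_m}(S) = Σ_{u∈S, v∉S} w_{H_m}(u,v) counts the edges leaving S with multiplicity. -/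

import Mathlib

open Finset

attribute [local instance] Classical.propDecidable

/-- `w'` is obtained from the multigraph `w` by adding, for each pair `(X, Y)` in the
collection `Cl`, a perfect matching between `X` and `Y` (given by a bijection `π p` from
`X` onto `Y`): the multiplicity of each edge `{x, π p x}` is increased by one. -/
def AddsMatchings {V : Type*} [Fintype V] (Cl : Finset (Finset V × Finset V))
    (w w' : V → V → ℕ) : Prop :=
  ∃ π : (Finset V × Finset V) → V → V,
    (∀ p ∈ Cl, Set.BijOn (π p) (↑p.1 : Set V) (↑p.2 : Set V)) ∧
    ∀ u v : V, w' u v = w u v + ∑ p ∈ Cl,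
      (p.1.filter (fun x => (u = x ∧ v = π p x) ∨ (v = x ∧ u = π p x))).card

/-- The number of ordered pairs, with multiplicity, joining different classes of `g`. -/
def crossing {V : Type*} [Fintype V] (w : V → V → ℕ) (g : V → ℕ) : ℕ :=
  ∑ u, ∑ v, if g u ≠ g v then w u v else 0

/-- The vertices carrying a nonzero label. -/
def labelled {V : Type*} [Fintype V] (g : V → ℕ) : Finset V :=
  univ.filter (fun v => g v ≠ 0)

/-- The nonzero classes of `g` are small and sparsely connected to the rest of the multigraph. -/
def IsSparseLabelling {V : Type*} [Fintype V] (s : ℕ) (w : V → V → ℕ) (g : V → ℕ) : Prop :=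
  (∀ k, k ≠ 0 → (univ.filter (fun v => g v = k)).card ≤ s) ∧
  24 * crossing w g ≤ (labelled g).card ∧ 4 * (labelled g).card ≤ 3 * Fintype.card V

/-- No small set of unlabelled vertices is sparse among the unlabelled vertices. -/
def IsSaturated {V : Type*} [Fintype V] (s : ℕ) (w : V → V → ℕ) (g : V → ℕ) : Prop :=
  ∀ B : Finset V, B ⊆ (labelled g)ᶜ → B.Nonempty → B.card ≤ s →
    B.card ≤ 24 * ∑ u ∈ B, ∑ v ∈ (labelled g)ᶜ \ B, (w u v + w v u)

/-- Every set of at most `s` vertices has edge expansion at least `1 / 144`. -/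
def IsSmallSetExpander {V : Type*} [Fintype V] (s : ℕ) (w : V → V → ℕ) : Prop :=
  ∀ S : Finset V, 1 ≤ S.card → S.card ≤ s → S.card ≤ 144 * ∑ u ∈ S, ∑ v ∈ Sᶜ, w u v

lemma exists_larger_sparseLabelling {V : Type*} [Fintype V] {s : ℕ} (w : V → V → ℕ)
    (hs : 2 * s ≤ Fintype.card V) {g : V → ℕ} (hg : IsSparseLabelling s w g)
    (hU : 4 * (labelled g).card < Fintype.card V) (hB : ¬ IsSaturated s w g) :
    ∃ g', IsSparseLabelling s w g' ∧ (labelled g).card < (labelled g').card := by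
  obtain ⟨h1, h2, h3⟩ := hg
  unfold IsSaturated at hB
  push Not at hB
  obtain ⟨B, hBU, hBne, hBs, hBe⟩ := hB
  have hB0 : ∀ v ∈ B, g v = 0 := by
    intro v hv
    have := hBU hv
    simpa [labelled] using this
  set K := univ.sup g + 1 with hK
  have hgK : ∀ v, g v < K := fun v => Nat.lt_succ_of_le (Finset.le_sup (f := g) (mem_univ v))
  let g' : V → ℕ := fun v => if v ∈ B then K else g v
  have hlab : labelled g' = labelled g ∪ B := by
    ext v
    by_cases hv : v ∈ B <;> simp [labelled, g', hv, hK]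
  have hdisj : Disjoint (labelled g) B := by
    rw [Finset.disjoint_left]
    intro v hv hvB
    have := hBU hvB
    simp at this
    exact this hv
  have hcard : (labelled g').card = (labelled g).card + B.card := by
    rw [hlab, card_union_of_disjoint hdisj]
  have hcross : crossing w g' ≤
      crossing w g + ∑ u ∈ B, ∑ v ∈ (labelled g)ᶜ \ B, (w u v + w v u) := by
    have e1 : ∑ u ∈ B, ∑ v ∈ (labelled g)ᶜ \ B, (w u v + w v u) =
        ∑ u, ∑ v, ((if u ∈ B ∧ v ∈ (labelled g)ᶜ \ B then w u v else 0) +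
          (if v ∈ B ∧ u ∈ (labelled g)ᶜ \ B then w u v else 0)) := by
      simp only [sum_add_distrib]
      congr 1
      · simp only [ite_and, sum_ite_irrel, sum_const_zero, Finset.sum_ite_mem, univ_inter]
      · rw [Finset.sum_comm (s := univ) (t := univ)]
        simp only [ite_and, sum_ite_irrel, sum_const_zero, Finset.sum_ite_mem, univ_inter]
    rw [e1]
    unfold crossing
    rw [← sum_add_distrib]
    refine sum_le_sum fun u _ => ?_
    rw [← sum_add_distrib]
    refine sum_le_sum fun v _ => ?_
    by_cases hu : u ∈ B <;> by_cases hv : v ∈ B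
    · simp [g', hu, hv]
    · by_cases h0 : g v = 0
      · simp [g', hu, hv, h0, labelled, hB0 u hu]
      · have : g u ≠ g v := by rw [hB0 u hu]; exact fun h => h0 h.symm
        simp [this]
        split_ifs <;> omega
    · by_cases h0 : g u = 0
      · simp [g', hu, hv, h0, labelled, hB0 v hv]
      · have : g u ≠ g v := by rw [hB0 v hv]; exact h0
        simp [this]
        split_ifs <;> omega
    · simp [g', hu, hv]
  refine ⟨g', ⟨?_, by omega, by omega⟩, ?_⟩
  · intro k hk
    by_cases hkK : k = K
    · refine (card_le_card ?_).trans hBs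
      intro v hv
      by_contra hvB
      simp [g', hvB] at hv
      have := hgK v
      omega
    · refine (card_le_card ?_).trans (h1 k hk)
      intro v hv
      by_cases hvB : v ∈ B
      · simp [g', hvB] at hv
        omega
      · simpa [g', hvB] using hv
  · have := hBne.card_pos
    omega

lemma exists_balanced_or_saturated {V : Type*} [Fintype V] {s : ℕ} (w : V → V → ℕ)
    (hs : 2 * s ≤ Fintype.card V) :
    ∃ g, IsSparseLabelling s w g ∧
      (Fintype.card V ≤ 4 * (labelled g).card ∨ IsSaturated s w g) := by
  by_contra hcon
  push Not at hcon
  have key : ∀ k : ℕ, ∃ g, IsSparseLabelling s w g ∧ k ≤ (labelled g).card := by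
    intro k
    induction k with
    | zero =>
      refine ⟨fun _ => 0, ⟨?_, ?_, ?_⟩, by simp⟩
      · intro k hk
        simp [hk.symm]
      · simp [crossing]
      · simp [labelled]
    | succ k ih =>
      obtain ⟨g, hg, hk⟩ := ih
      obtain ⟨hU, hB⟩ := hcon g hg
      obtain ⟨g', hg', hlt⟩ := exists_larger_sparseLabelling w hs hg hU hB
      exact ⟨g', hg', by omega⟩
  obtain ⟨g, -, hk⟩ := key (Fintype.card V + 1)
  have := card_le_univ (labelled g)
  omega

/-- The cut chosen by the cut player: it separates labelled from unlabelled vertices, and it is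
either large or covers all labelled vertices of a saturated labelling. -/
lemma exists_cut {V : Type*} [Fintype V] {s : ℕ} (w : V → V → ℕ)
    (hs : 2 * s ≤ Fintype.card V) :
    ∃ p : Finset V × Finset V, p.1.card = p.2.card ∧ ∃ g, IsSparseLabelling s w g ∧
      p.1 ⊆ labelled g ∧ p.2 ⊆ (labelled g)ᶜ ∧
      (Fintype.card V ≤ 4 * p.1.card ∨ (p.1 = labelled g ∧ IsSaturated s w g)) := by
  obtain ⟨g, hg, h⟩ := exists_balanced_or_saturated w hs
  have hc := card_compl (labelled g)
  have hle := card_le_univ (labelled g)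
  have h3 := hg.2.2
  by_cases hU : Fintype.card V ≤ 4 * (labelled g).card
  · obtain ⟨X, hX, hXc⟩ := exists_subset_card_eq
      (min_le_left (labelled g).card ((labelled g)ᶜ).card)
    obtain ⟨Y, hY, hYc⟩ := exists_subset_card_eq
      (min_le_right (labelled g).card ((labelled g)ᶜ).card)
    exact ⟨(X, Y), hXc.trans hYc.symm, g, hg, hX, hY, Or.inl (by simp only; omega)⟩
  · obtain ⟨Y, hY, hYc⟩ := exists_subset_card_eq
      (show (labelled g).card ≤ ((labelled g)ᶜ).card by omega)
    exact ⟨(labelled g, Y), hYc.symm, g, hg, subset_rfl, hY,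
      Or.inr ⟨rfl, h.resolve_left hU⟩⟩

/-- Adding a single matching is the same as adding the edges of an involution exchanging the
two sides. -/
lemma AddsMatchings.exists_involution {V : Type*} [Fintype V] {p : Finset V × Finset V}
    {w w' : V → V → ℕ} (hp : Disjoint p.1 p.2) (h : AddsMatchings {p} w w') :
    ∃ M : V → V, Function.Involutive M ∧ (∀ x ∈ p.1, M x ∈ p.2) ∧
      ∀ u v, w' u v = w u v + if M u = v ∧ u ≠ v then 1 else 0 := by
  obtain ⟨π, hπ, hw⟩ := h
  have hb := hπ p (mem_singleton_self p)
  obtain ⟨X, Y⟩ := p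
  set f := π (X, Y) with hf
  simp only at hb hp
  have hdis : ∀ x, x ∈ X → x ∉ Y := fun x hx hy => (Finset.disjoint_left.mp hp) hx hy
  have hfX : ∀ x ∈ X, f x ∈ Y := fun x hx => hb.mapsTo hx
  obtain ⟨k, hk⟩ : ∃ k : V → V, ∀ y ∈ Y, k y ∈ X ∧ f (k y) = y := by
    have : ∀ y, ∃ x, y ∈ Y → x ∈ X ∧ f x = y := by
      intro y
      by_cases hy : y ∈ Y
      · obtain ⟨x, hx, hxy⟩ := hb.surjOn hy
        exact ⟨x, fun _ => ⟨hx, hxy⟩⟩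
      · exact ⟨y, fun h => absurd h hy⟩
    choose k hk using this
    exact ⟨k, hk⟩
  have hkf : ∀ x ∈ X, k (f x) = x := fun x hx =>
    hb.injOn (hk _ (hfX x hx)).1 hx (hk _ (hfX x hx)).2
  have hXM : ∀ x ∈ X, (if x ∈ X then f x else if x ∈ Y then k x else x) = f x := by
    intro x hx; simp [hx]
  refine ⟨fun v => if v ∈ X then f v else if v ∈ Y then k v else v, ?_, ?_, ?_⟩
  · intro v
    by_cases hX : v ∈ X
    · have h1 := hfX v hX
      have h2 : f v ∉ X := fun h => hdis _ h h1
      simp [hX, h1, h2, hkf v hX]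
    · by_cases hY : v ∈ Y
      · simp [hX, hY, hk v hY]
      · simp [hX, hY]
  · intro x hx
    simpa [hx] using hfX x hx
  · intro u v
    rw [hw, sum_singleton]
    congr 1
    simp only [← hf]
    by_cases hX : u ∈ X
    · have hne : u ≠ f u := fun h => hdis u hX (h ▸ hfX u hX)
      by_cases huv : f u = v
      · have : X.filter (fun x => (u = x ∧ v = f x) ∨ (v = x ∧ u = f x)) = {u} := by
          ext x
          simp only [mem_filter, mem_singleton]
          constructor
          · rintro ⟨hx, ⟨h, -⟩ | ⟨h, -⟩⟩
            · exact h.symm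
            · exact absurd (hfX u hX) (hdis _ (by rw [huv, h]; exact hx))
          · rintro rfl
            exact ⟨hX, Or.inl ⟨rfl, huv.symm⟩⟩
        rw [this]
        have hne' : u ≠ v := huv ▸ hne
        simp [hX, huv, hne']
      · rw [if_neg (by simp [hX, huv]), card_eq_zero, filter_eq_empty_iff]
        rintro x hx (⟨rfl, h⟩ | ⟨rfl, h⟩)
        · exact huv h.symm
        · exact hdis u hX (h ▸ hfX _ hx)
    · by_cases hY : u ∈ Y
      · obtain ⟨hkX, hku⟩ := hk u hY
        by_cases huv : k u = v
        · have : X.filter (fun x => (u = x ∧ v = f x) ∨ (v = x ∧ u = f x)) = {v} := by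
            ext x
            simp only [mem_filter, mem_singleton]
            constructor
            · rintro ⟨hx, ⟨h, -⟩ | ⟨h, -⟩⟩
              · exact absurd (h ▸ hx) hX
              · exact h.symm
            · rintro rfl
              exact ⟨huv ▸ hkX, Or.inr ⟨rfl, by rw [← huv, hku]⟩⟩
          rw [this]
          have hne' : u ≠ v := fun h => hX (by rw [h, ← huv]; exact hkX)
          simp [hX, hY, huv, hne']
        · rw [if_neg (by simp [hX, hY, huv]), card_eq_zero, filter_eq_empty_iff]
          rintro x hx (⟨rfl, h⟩ | ⟨rfl, h⟩)
          · exact hX hx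
          · exact huv (by rw [h, hkf _ hx])
      · rw [if_neg (by simp [hX, hY]), card_eq_zero, filter_eq_empty_iff]
        rintro x hx (⟨rfl, h⟩ | ⟨rfl, h⟩)
        · exact hX hx
        · exact hY (h ▸ hfX _ hx)

lemma isSmallSetExpander_of_isSaturated {V : Type*} [Fintype V] {s : ℕ} {w w' : V → V → ℕ}
    {g : V → ℕ} {M : V → V} (hsymm : ∀ u v, w u v = w v u) (hg : IsSaturated s w g)
    (hM : Function.Involutive M) (hMU : ∀ x ∈ labelled g, M x ∈ (labelled g)ᶜ)
    (hw : ∀ u v, w' u v = w u v + if M u = v ∧ u ≠ v then 1 else 0) :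
    IsSmallSetExpander s w' := by
  intro S hS1 hSs
  set A := S ∩ labelled g with hA
  set B := S \ labelled g with hB
  have hAB : A.card + B.card = S.card := card_inter_add_card_sdiff S (labelled g)
  by_cases hcase : S.card ≤ 3 * B.card
  · have hBU : B ⊆ (labelled g)ᶜ := by
      intro v hv
      simp only [hB, mem_sdiff] at hv
      simpa using hv.2
    have h1 := hg B hBU (card_pos.mp (by omega)) (by omega)
    have h2 : ∑ u ∈ B, ∑ v ∈ (labelled g)ᶜ \ B, (w u v + w v u) ≤
        2 * ∑ u ∈ S, ∑ v ∈ Sᶜ, w' u v := by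
      have hsub : (labelled g)ᶜ \ B ⊆ Sᶜ := by
        intro v hv
        simp only [hB, mem_sdiff, mem_compl] at hv ⊢
        tauto
      calc ∑ u ∈ B, ∑ v ∈ (labelled g)ᶜ \ B, (w u v + w v u)
          ≤ ∑ u ∈ B, ∑ v ∈ Sᶜ, 2 * w' u v := by
            refine sum_le_sum fun u _ => (sum_le_sum_of_subset hsub).trans
              (sum_le_sum fun v _ => ?_)
            rw [hw, hsymm v u]
            omega
        _ ≤ ∑ u ∈ S, ∑ v ∈ Sᶜ, 2 * w' u v := sum_le_sum_of_subset sdiff_subset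
        _ = 2 * ∑ u ∈ S, ∑ v ∈ Sᶜ, w' u v := by simp only [mul_sum]
    omega
  · have h1 : (A.filter (fun x => M x ∈ S)).card ≤ B.card := by
      refine card_le_card_of_injOn M ?_ (hM.injective.injOn)
      intro x hx
      simp only [hA, coe_filter, mem_inter, Set.mem_ofPred_eq] at hx
      have := hMU x hx.1.2
      simp only [hB, coe_sdiff, Set.mem_sdiff, mem_coe]
      exact ⟨hx.2, by simpa using this⟩
    have h2 : (A.filter (fun x => M x ∉ S)).card ≤ ∑ u ∈ S, ∑ v ∈ Sᶜ, w' u v := by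
      calc (A.filter (fun x => M x ∉ S)).card
          = ∑ u ∈ A.filter (fun x => M x ∉ S), 1 := by simp
        _ ≤ ∑ u ∈ A.filter (fun x => M x ∉ S), ∑ v ∈ Sᶜ, w' u v := by
            refine sum_le_sum fun u hu => ?_
            simp only [hA, mem_filter, mem_inter] at hu
            have hmem : M u ∈ Sᶜ := by simpa using hu.2
            refine le_trans ?_ (single_le_sum (f := fun v => w' u v)
              (fun _ _ => Nat.zero_le _) hmem)
            have : u ≠ M u := fun h => hu.2 (h ▸ hu.1.1)
            simp [hw, this]
        _ ≤ ∑ u ∈ S, ∑ v ∈ Sᶜ, w' u v :=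
            sum_le_sum_of_subset ((filter_subset _ _).trans inter_subset_left)
    have h3 := card_filter_add_card_filter_not (s := A) (fun x => M x ∈ S)
    omega

/-- A concave entropy function, truncated at scale `τ`. -/
noncomputable def truncEntropy (τ x : ℝ) : ℝ := -(x * Real.log (x + τ))

lemma truncEntropy_midpoint_nonneg {τ a b : ℝ} (hτ : 0 < τ) (ha : 0 ≤ a) (hb : 0 ≤ b) :
    0 ≤ 2 * truncEntropy τ ((a + b) / 2) - truncEntropy τ a - truncEntropy τ b := by
  unfold truncEntropy
  have hα : 0 < a + τ := by linarith
  have hβ : 0 < b + τ := by linarith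
  have hm : 0 < (a + b) / 2 + τ := by linarith
  have h1 := Real.log_le_sub_one_of_pos (div_pos hm hα)
  have h2 := Real.log_le_sub_one_of_pos (div_pos hm hβ)
  rw [Real.log_div hm.ne' hα.ne'] at h1
  rw [Real.log_div hm.ne' hβ.ne'] at h2
  have h3 := mul_le_mul_of_nonneg_left h1 ha
  have h4 := mul_le_mul_of_nonneg_left h2 hb
  have h5 : a * (((a + b) / 2 + τ) / (a + τ) - 1) + b * (((a + b) / 2 + τ) / (b + τ) - 1) ≤ 0 := by
    have : a * (((a + b) / 2 + τ) / (a + τ) - 1) + b * (((a + b) / 2 + τ) / (b + τ) - 1)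
        = -(τ * (a - b) ^ 2 / (2 * (a + τ) * (b + τ))) := by
      field_simp
      ring
    rw [this, neg_nonpos]
    positivity
  nlinarith

lemma truncEntropy_midpoint_gain {τ a b : ℝ} (hτ : 0 < τ) (ha : 0 ≤ a) (hb : 0 ≤ b) :
    a / 6 - b / 2 - 2 * τ ≤
      2 * truncEntropy τ ((a + b) / 2) - truncEntropy τ a - truncEntropy τ b := by
  unfold truncEntropy
  have hα : 0 < a + τ := by linarith
  have hβ : 0 < b + τ := by linarith
  have hm : 0 < (a + b) / 2 + τ := by linarith
  have h1 := Real.log_le_sub_one_of_pos (div_pos (mul_pos two_pos hm) hα)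
  have h2 := Real.log_le_sub_one_of_pos (div_pos hm hβ)
  rw [Real.log_div (by positivity) hα.ne', Real.log_mul two_ne_zero hm.ne'] at h1
  rw [Real.log_div hm.ne' hβ.ne'] at h2
  have h3 := mul_le_mul_of_nonneg_left h1 ha
  have h4 := mul_le_mul_of_nonneg_left h2 hb
  have h5 : a * (2 * ((a + b) / 2 + τ) / (a + τ) - 1) ≤ b + τ := by
    have : a * (2 * ((a + b) / 2 + τ) / (a + τ) - 1) = a / (a + τ) * (b + τ) := by
      field_simp
      ring
    rw [this]
    exact mul_le_of_le_one_left hβ.le ((div_le_one hα).2 (by linarith))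
  have h6 : b * (((a + b) / 2 + τ) / (b + τ) - 1) ≤ (a + b) / 2 + τ - b := by
    have : b * (((a + b) / 2 + τ) / (b + τ) - 1) = b / (b + τ) * ((a + b) / 2 + τ) - b := by
      field_simp
    rw [this]
    have := mul_le_of_le_one_left hm.le ((div_le_one hβ).2 (by linarith : b ≤ b + τ))
    linarith
  have h7 := mul_le_mul_of_nonneg_left Real.log_two_gt_d9.le ha
  nlinarith

/-- `P` is a doubly stochastic matrix whose mass between different classes of any labelling is
bounded by the number of edges of `w` between them. -/
structure IsWalkMatrix {V : Type*} [Fintype V] (w : V → V → ℕ) (P : V → V → ℝ) : Prop where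
  nonneg : ∀ u v, 0 ≤ P u v
  row_sum : ∀ u, ∑ v, P u v = 1
  col_sum : ∀ v, ∑ u, P u v = 1
  leak_le : ∀ g : V → ℕ, 2 * ∑ u, ∑ v, (if g u ≠ g v then P u v else 0) ≤ (crossing w g : ℝ)

lemma IsWalkMatrix.step {V : Type*} [Fintype V] {w w' : V → V → ℕ} {P : V → V → ℝ}
    {M : V → V} (hP : IsWalkMatrix w P) (hM : Function.Involutive M)
    (hw : ∀ u v, w' u v = w u v + if M u = v ∧ u ≠ v then 1 else 0) :
    IsWalkMatrix w' (fun u v => (P u v + P u (M v)) / 2) where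
  nonneg u v := by
    have := hP.nonneg u v
    have := hP.nonneg u (M v)
    positivity
  row_sum u := by
    have h : ∑ v, P u (M v) = ∑ v, P u v := Equiv.sum_comp hM.toPerm (fun v => P u v)
    rw [← sum_div, sum_add_distrib, h, hP.row_sum]
    norm_num
  col_sum v := by
    rw [← sum_div, sum_add_distrib, hP.col_sum, hP.col_sum]
    norm_num
  leak_le g := by
    have hcross : (crossing w' g : ℝ) =
        crossing w g + ∑ v, if g v ≠ g (M v) then (1 : ℝ) else 0 := by
      unfold crossing
      push_cast
      rw [← sum_add_distrib]
      refine sum_congr rfl fun u _ => ?_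
      have : (if g u ≠ g (M u) then (1 : ℝ) else 0) =
          ∑ v, if v = M u then (if g u ≠ g v then 1 else 0) else 0 := by
        rw [sum_ite_eq' univ (M u)]; simp
      rw [this, ← sum_add_distrib]
      refine sum_congr rfl fun v _ => ?_
      rw [hw]
      by_cases hg : g u = g v
      · simp [hg]
      · have hne : u ≠ v := fun h => hg (by rw [h])
        by_cases hv : v = M u
        · simp [hv, hv ▸ hg, hv ▸ hne]
        · simp [hg, hv, Ne.symm hv]
    have hre : ∑ u, ∑ v, (if g u ≠ g v then P u (M v) else 0) =
        ∑ u, ∑ v, (if g u ≠ g (M v) then P u v else 0) := by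
      refine sum_congr rfl fun u _ => ?_
      rw [← Equiv.sum_comp hM.toPerm (fun v => if g u ≠ g v then P u (M v) else 0)]
      refine sum_congr rfl fun v _ => ?_
      simp [hM v]
    have hle : ∑ u, ∑ v, (if g u ≠ g (M v) then P u v else 0) ≤
        ∑ u, ∑ v, (if g u ≠ g v then P u v else 0) +
          ∑ v, if g v ≠ g (M v) then (1 : ℝ) else 0 := by
      have : (∑ v, if g v ≠ g (M v) then (1 : ℝ) else 0) =
          ∑ u, ∑ v, if g v ≠ g (M v) then P u v else 0 := by
        rw [sum_comm]
        refine sum_congr rfl fun v _ => ?_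
        split_ifs
        · exact (hP.col_sum v).symm
        · simp
      rw [this, ← sum_add_distrib]
      refine sum_le_sum fun u _ => ?_
      rw [← sum_add_distrib]
      refine sum_le_sum fun v _ => ?_
      have := hP.nonneg u v
      by_cases h1 : g u = g v
      · simp [h1]
      · simp only [ne_eq, h1, not_false_eq_true, if_true]
        split_ifs <;> linarith
    have hsplit : ∑ u, ∑ v, (if g u ≠ g v then (P u v + P u (M v)) / 2 else 0) =
        (∑ u, ∑ v, (if g u ≠ g v then P u v else 0) +
          ∑ u, ∑ v, (if g u ≠ g v then P u (M v) else 0)) / 2 := by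
      rw [← sum_add_distrib, sum_div]
      refine sum_congr rfl fun u _ => ?_
      rw [← sum_add_distrib, sum_div]
      refine sum_congr rfl fun v _ => ?_
      split_ifs <;> simp
    rw [hsplit, hcross, hre]
    have := hP.leak_le g
    linarith

lemma isWalkMatrix_one {V : Type*} [Fintype V] {w : V → V → ℕ} :
    IsWalkMatrix w (fun u v => if u = v then 1 else 0) where
  nonneg u v := by positivity
  row_sum u := by simp
  col_sum v := by simp
  leak_le g := by
    have : ∑ u, ∑ v, (if g u ≠ g v then (if u = v then (1 : ℝ) else 0) else 0) = 0 := by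
      refine sum_eq_zero fun u _ => sum_eq_zero fun v _ => ?_
      by_cases h : u = v <;> simp [h]
    rw [this]
    simp

lemma sum_truncEntropy_le {V : Type*} [Fintype V] {w : V → V → ℕ} {P : V → V → ℝ} {τ : ℝ}
    (hτ : 0 < τ) (hP : IsWalkMatrix w P) :
    ∑ u, ∑ v, truncEntropy τ (P u v) ≤ Fintype.card V * (-Real.log τ) := by
  have : ∀ u, ∑ v, truncEntropy τ (P u v) ≤ -Real.log τ := by
    intro u
    calc ∑ v, truncEntropy τ (P u v) ≤ ∑ v, P u v * (-Real.log τ) := by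
          refine sum_le_sum fun v _ => ?_
          have h0 := hP.nonneg u v
          have := mul_le_mul_of_nonneg_left
            (Real.log_le_log hτ (by linarith : τ ≤ P u v + τ)) h0
          unfold truncEntropy
          linarith
      _ = -Real.log τ := by rw [← sum_mul, hP.row_sum, one_mul]
  calc _ ≤ ∑ _u : V, -Real.log τ := sum_le_sum fun u _ => this u
    _ = _ := by simp

lemma sum_truncEntropy_one_ge {V : Type*} [Fintype V] {τ : ℝ} (hτ : 0 < τ) (hτ1 : τ ≤ 1) :
    -(Fintype.card V : ℝ) ≤ ∑ u : V, ∑ v : V, truncEntropy τ (if u = v then 1 else 0) := by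
  have h : ∀ u : V, -1 ≤ ∑ v : V, truncEntropy τ (if u = v then 1 else 0) := by
    intro u
    rw [sum_eq_single u (fun v _ hv => by simp [truncEntropy, hv.symm]) (by simp)]
    have := Real.log_le_sub_one_of_pos (show 0 < 1 + τ by linarith)
    simp only [truncEntropy, if_true]
    linarith
  calc -(Fintype.card V : ℝ) = ∑ _u : V, (-1 : ℝ) := by simp
    _ ≤ _ := sum_le_sum fun u _ => h u

/-- Matching a large part of the labelled vertices to unlabelled ones increases the entropy of
the walk. -/
lemma IsWalkMatrix.entropy_gain {V : Type*} [Fintype V] {s : ℕ} {w : V → V → ℕ}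
    {P : V → V → ℝ} {M : V → V} {g : V → ℕ} {X : Finset V} (hs : 0 < s)
    (hP : IsWalkMatrix w P) (hM : Function.Involutive M) (hg : IsSparseLabelling s w g)
    (hX : X ⊆ labelled g) (hMX : ∀ x ∈ X, M x ∈ (labelled g)ᶜ)
    (hXc : Fintype.card V ≤ 4 * X.card) :
    ∑ u, ∑ v, truncEntropy (1 / (24 * s)) (P u v) + (Fintype.card V : ℝ) / 192 ≤
      ∑ u, ∑ v, truncEntropy (1 / (24 * s)) ((P u v + P u (M v)) / 2) := by
  have hs' : (0 : ℝ) < s := by exact_mod_cast hs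
  set τ : ℝ := 1 / (24 * s) with hτdef
  have hτ : 0 < τ := by positivity
  have hτs : τ * s = 1 / 24 := by rw [hτdef]; field_simp
  set L := ∑ u, ∑ v, (if g u ≠ g v then P u v else 0) with hL
  have hL' : ∑ u, ∑ v, (if g u ≠ g (M v) then P u (M v) else 0) = L := by
    refine sum_congr rfl fun u _ => ?_
    exact Equiv.sum_comp hM.toPerm (fun v => if g u ≠ g v then P u v else 0)
  have hre : ∑ u, ∑ v, truncEntropy τ (P u (M v)) = ∑ u, ∑ v, truncEntropy τ (P u v) :=
    sum_congr rfl fun u _ => Equiv.sum_comp hM.toPerm (fun v => truncEntropy τ (P u v))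
  have hpt : ∀ u v, (if v ∈ X then P u v / 6 - 2 * τ * (if g u = g v then 1 else 0) else 0)
      - (if g u ≠ g v then P u v else 0) / 6 - (if g u ≠ g (M v) then P u (M v) else 0) / 2 ≤
      2 * truncEntropy τ ((P u v + P u (M v)) / 2) - truncEntropy τ (P u v)
        - truncEntropy τ (P u (M v)) := by
    intro u v
    have ha := hP.nonneg u v
    have hb := hP.nonneg u (M v)
    have h0 := truncEntropy_midpoint_nonneg hτ ha hb
    have h1 := truncEntropy_midpoint_gain hτ ha hb
    have h2 : 0 ≤ (if g u ≠ g (M v) then P u (M v) else 0) := by split_ifs <;> simp [hb]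
    have h3 : 0 ≤ (if g u ≠ g v then P u v else 0) := by split_ifs <;> simp [ha]
    by_cases hv : v ∈ X
    · by_cases huv : g u = g v
      · have hv0 : g v ≠ 0 := by simpa [labelled] using hX hv
        have hMv0 : g (M v) = 0 := by simpa [labelled] using hMX v hv
        have : g u ≠ g (M v) := by rw [huv, hMv0]; exact hv0
        rw [if_pos hv, if_pos huv, if_neg (not_not.2 huv), if_pos this]
        linarith
      · rw [if_pos hv, if_neg huv, if_pos huv]
        linarith
    · rw [if_neg hv]
      linarith
  have hsum := sum_le_sum (s := univ) fun u _ => sum_le_sum (s := univ) fun v _ => hpt u v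
  simp only [sum_sub_distrib, ← sum_div, ← mul_sum] at hsum
  rw [hL', hre] at hsum
  have hmain : (X.card : ℝ) / 6 - X.card * (1 / 12) ≤
      ∑ u, ∑ v, (if v ∈ X then P u v / 6 - 2 * τ * (if g u = g v then 1 else 0) else 0) := by
    rw [sum_comm]
    have hx : ∀ v ∈ X, (1 : ℝ) / 6 - 1 / 12 ≤
        ∑ u, (P u v / 6 - 2 * τ * (if g u = g v then 1 else 0)) := by
      intro v hv
      have hv0 : g v ≠ 0 := by simpa [labelled] using hX hv
      have hc : ((univ.filter (fun u => g u = g v)).card : ℝ) ≤ s := by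
        exact_mod_cast hg.1 (g v) hv0
      rw [sum_sub_distrib, ← sum_div, hP.col_sum, ← mul_sum, sum_boole]
      have := mul_le_mul_of_nonneg_left hc hτ.le
      linarith
    calc (X.card : ℝ) / 6 - X.card * (1 / 12) = ∑ v ∈ X, ((1 : ℝ) / 6 - 1 / 12) := by
          rw [sum_const, nsmul_eq_mul]; ring
      _ ≤ ∑ v ∈ X, ∑ u, (P u v / 6 - 2 * τ * (if g u = g v then 1 else 0)) := sum_le_sum hx
      _ = _ := by
          rw [← sum_ite_mem_eq X]
          refine sum_congr rfl fun v _ => ?_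
          split_ifs <;> simp
  have hLc := hP.leak_le g
  have h2 : (24 * crossing w g : ℝ) ≤ (labelled g).card := by exact_mod_cast hg.2.1
  have h3 : (4 * (labelled g).card : ℝ) ≤ 3 * Fintype.card V := by exact_mod_cast hg.2.2
  have h4 : (Fintype.card V : ℝ) ≤ 4 * X.card := by exact_mod_cast hXc
  rw [← hL] at hLc hsum
  linarith

/-- Cut player strategy for building small set expanders in `O(log s)` rounds. -/
theorem cut_matching_small_set_expander :
    ∃ c c' : ℝ, 1 ≤ c ∧ 1 ≤ c' ∧
      ∀ (V : Type) [Fintype V] (n : ℕ), n = Fintype.card V → Even n → 2 ≤ n →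
        ∀ s : ℕ, 2 ≤ s → s ≤ n / 2 →
          ∃ σ : (V → V → ℕ) → Finset (Finset V × Finset V),
            (∀ w : V → V → ℕ, ((σ w).card : ℝ) ≤ c ∧
                ∀ p ∈ σ w, Disjoint p.1 p.2 ∧ p.1.card = p.2.card) ∧
            ∀ m : ℕ, c' * Real.log (s : ℝ) ≤ (m : ℝ) →
              ∀ H : ℕ → V → V → ℕ,
                (∀ u v, H 0 u v = 0) →
                (∀ i < m, AddsMatchings (σ (H i)) (H i) (H (i + 1))) →
                ∀ S : Finset V, 1 ≤ S.card → S.card ≤ s →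
                  (S.card : ℝ) / c ≤ ((∑ u ∈ S, ∑ v ∈ Sᶜ, H m u v : ℕ) : ℝ) := by
  refine ⟨144, 2000, by norm_num, by norm_num, ?_⟩
  intro V _ n hn _ hn2 s hs2 hsn
  have hs : 2 * s ≤ Fintype.card V := by omega
  choose cut hcard hcut using fun w : V → V → ℕ => exists_cut (s := s) w hs
  have hdisj : ∀ w, Disjoint (cut w).1 (cut w).2 := by
    intro w
    obtain ⟨g, -, h1, h2, -⟩ := hcut w
    exact disjoint_of_subset_left h1 (disjoint_of_subset_right h2 disjoint_compl_right)
  refine ⟨fun w => {cut w}, ?_, ?_⟩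
  · intro w
    refine ⟨by simp, ?_⟩
    intro p hp
    rw [mem_singleton] at hp
    subst hp
    exact ⟨hdisj w, hcard w⟩
  intro m hm H h0 hstep
  have hs0 : (0 : ℝ) < s := by exact_mod_cast (by omega : 0 < s)
  have hs2' : (2 : ℝ) ≤ s := by exact_mod_cast hs2
  set τ : ℝ := 1 / (24 * s) with hτdef
  have hτ : 0 < τ := by positivity
  have hτ1 : τ ≤ 1 := by
    rw [hτdef, div_le_one (by positivity)]
    linarith
  have key : ∀ i ≤ m, (∀ u v, H i u v = H i v u) ∧ (IsSmallSetExpander s (H i) ∨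
      ∃ P, IsWalkMatrix (H i) P ∧
        (i : ℝ) * ((Fintype.card V : ℝ) / 192) - Fintype.card V ≤
          ∑ u, ∑ v, truncEntropy τ (P u v)) := by
    intro i
    induction i with
    | zero =>
      intro _
      refine ⟨fun u v => by rw [h0, h0], Or.inr ⟨_, isWalkMatrix_one, ?_⟩⟩
      have := sum_truncEntropy_one_ge (V := V) hτ hτ1
      simpa using this
    | succ i ih =>
      intro hi
      obtain ⟨hsymm, hor⟩ := ih (by omega)
      obtain ⟨M, hM, hMX, hw⟩ := (hstep i (by omega)).exists_involution (hdisj (H i))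
      refine ⟨?_, ?_⟩
      · intro u v
        rw [hw, hw, hsymm u v]
        congr 1
        have : (M u = v ∧ u ≠ v) ↔ (M v = u ∧ v ≠ u) := by
          constructor
          · rintro ⟨rfl, h⟩
            exact ⟨hM u, h.symm⟩
          · rintro ⟨rfl, h⟩
            exact ⟨hM v, h.symm⟩
        simp only [this]
      · rcases hor with hgood | ⟨P, hP, hΦ⟩
        · left
          intro S h1 h2
          refine (hgood S h1 h2).trans (Nat.mul_le_mul_left _ ?_)
          refine sum_le_sum fun u _ => sum_le_sum fun v _ => ?_
          rw [hw]
          omega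
        · obtain ⟨g, hg, hXU, hYU, hbig | ⟨hXeq, hsat⟩⟩ := hcut (H i)
          · right
            refine ⟨_, hP.step hM hw, ?_⟩
            have := hP.entropy_gain (by omega) hM hg hXU (fun x hx => hYU (hMX x hx)) hbig
            rw [← hτdef] at this
            push_cast
            linarith
          · left
            refine isSmallSetExpander_of_isSaturated hsymm hsat hM ?_ hw
            intro x hx
            exact hYU (hMX x (hXeq ▸ hx))
  intro S hS1 hSs
  have hgood : IsSmallSetExpander s (H m) := by
    rcases (key m le_rfl).2 with h | ⟨P, hP, hΦ⟩
    · exact h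
    · exfalso
      have hle := sum_truncEntropy_le hτ hP
      have hlog : -Real.log τ = Real.log 24 + Real.log s := by
        rw [hτdef, one_div, Real.log_inv, neg_neg, Real.log_mul (by norm_num) hs0.ne']
      have h24 : Real.log 24 ≤ 5 * Real.log 2 := by
        rw [show (5 : ℝ) * Real.log 2 = Real.log (2 ^ 5) by rw [Real.log_pow]; norm_num]
        exact Real.log_le_log (by norm_num) (by norm_num)
      have h2s : Real.log 2 ≤ Real.log s := Real.log_le_log two_pos hs2'
      have hl2 := Real.log_two_gt_d9
      have hV : (0 : ℝ) < Fintype.card V := by exact_mod_cast (by omega : 0 < Fintype.card V)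
      have hcontr : (Fintype.card V : ℝ) * ((m : ℝ) / 192 - 1) ≤
          Fintype.card V * (Real.log 24 + Real.log s) := by
        rw [← hlog]
        linarith
      have := le_of_mul_le_mul_left hcontr hV
      linarith
  have h := hgood S hS1 hSs
  rw [div_le_iff₀ (by norm_num)]
  have h' : (S.card : ℝ) ≤ 144 * ((∑ u ∈ S, ∑ v ∈ Sᶜ, H m u v : ℕ) : ℝ) := by exact_mod_cast h
  linarith
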